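/- Let q be an odd positive integer and let a, b be integers with gcd(a, q) = 1. Then Σ_{x mod q} e_q(a x² + b x) = q^{1/2} ε_q (a | q) e_q(−c b²), where (a | q) is the Jacobi symbol and c is any integer with 4 a c ≡ 1 (mod q). -/

import Mathlib

open Complex

/-- `eN q x = e^{2πix/q}`. -/
noncomputable def eN (q : ℕ) (x : ℤ) : ℂ := Complex.exp (2 * Real.pi * Complex.I * x / q)

/-- `εq = 1` if `q ≡ 1 (mod 4)`, and `εq = i` if `q ≡ 3 (mod 4)`. -/
noncomputable def epsFactor (q : ℕ) : ℂ := if q % 4 = 1 then 1 else Complex.I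

open Filter Topology

theorem summable_exp_neg_pi_mul_int_sq {T : ℝ} (hT : 0 < T) :
    Summable fun n : ℤ ↦ Real.exp (-Real.pi * T * n ^ 2) := by
  have h := summable_pow_mul_jacobiTheta₂_term_bound 0 hT 0
  refine h.congr fun n ↦ ?_
  simp [mul_assoc]

theorem tsum_periodic_mul_exp_eq {N : ℕ} [NeZero N] {f : ℤ → ℂ} (hf : Function.Periodic f N)
    {w : ℂ} (hw : 0 < w.re) :
    ∑' n : ℤ, f n * cexp (-Real.pi * (n ^ 2 / (N ^ 2 * w))) =
      w ^ (1 / 2 : ℂ) * ∑ r : Fin N, f r *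
        ∑' k : ℤ, cexp (-Real.pi * w * k ^ 2 + 2 * Real.pi * (-(I * (r / N))) * k) := by
  have hN : (N : ℂ) ≠ 0 := NeZero.ne _
  have hw0 : w ≠ 0 := by rintro rfl; simp at hw
  have hs : w ^ (1 / 2 : ℂ) ≠ 0 := by simp [cpow_eq_zero_iff, hw0]
  have hsum : Summable fun n : ℤ ↦ f n * cexp (-Real.pi * (n ^ 2 / (N ^ 2 * w))) := by
    have hT : 0 < (1 / (N ^ 2 * w)).re := by
      have h1 : (1 / (N ^ 2 * w)) = ((1 / (N : ℝ) ^ 2 : ℝ) : ℂ) * w⁻¹ := by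
        push_cast; field_simp
      have h2 : 0 < Complex.normSq w := Complex.normSq_pos.2 hw0
      have h3 : (0 : ℝ) < N := by exact_mod_cast Nat.pos_of_ne_zero (NeZero.ne N)
      rw [h1, Complex.re_ofReal_mul, Complex.inv_re]
      positivity
    obtain ⟨C, hC⟩ : ∃ C, ∀ n, ‖f n‖ ≤ C := by
      refine ⟨∑ r : Fin N, ‖f r‖, fun n ↦ ?_⟩
      have hn : f n = f (((Int.divModEquiv N n).2 : ℕ) : ℤ) := by
        conv_lhs => rw [← (Int.divModEquiv N).symm_apply_apply n]
        rw [Int.divModEquiv_symm_apply, add_comm]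
        simpa using hf.int_mul (Int.divModEquiv N n).1 _
      rw [hn]
      exact Finset.single_le_sum (f := fun r : Fin N ↦ ‖f r‖) (fun _ _ ↦ norm_nonneg _)
        (Finset.mem_univ _)
    refine Summable.of_norm_bounded ((summable_exp_neg_pi_mul_int_sq hT).mul_left C) fun n ↦ ?_
    rw [norm_mul, Complex.norm_exp]
    refine mul_le_mul (hC n) (le_of_eq ?_) (Real.exp_nonneg _) ((norm_nonneg _).trans (hC n))
    congr 1
    have : (-(Real.pi : ℂ) * (n ^ 2 / (N ^ 2 * w))) =
      ((-Real.pi * n ^ 2 : ℝ) : ℂ) * (1 / (N ^ 2 * w)) := by push_cast; ring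
    rw [this, Complex.re_ofReal_mul]
    ring
  have hsum' := ((Equiv.prodComm (Fin N) ℤ).trans (Int.divModEquiv N).symm).summable_iff.2 hsum
  rw [← ((Equiv.prodComm (Fin N) ℤ).trans (Int.divModEquiv N).symm).tsum_eq]
  refine (hsum'.tsum_prod).trans ?_
  rw [tsum_fintype, Finset.mul_sum]
  refine Finset.sum_congr rfl fun r _ ↦ ?_
  rw [Complex.tsum_exp_neg_quadratic hw, mul_left_comm, ← mul_assoc (w ^ _), mul_one_div_cancel hs,
    one_mul, ← tsum_mul_left]
  refine tsum_congr fun k ↦ ?_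
  simp only [Function.comp, Equiv.trans_apply, Equiv.prodComm_apply, Prod.swap_prod_mk, Int.divModEquiv_symm_apply]
  have h1 : f (k * N + (r : ℕ)) = f (r : ℕ) := by
    rw [add_comm]
    simpa using hf.int_mul k _
  rw [h1]
  congr 2
  push_cast
  have h2 : (k : ℂ) + I * -(I * (r / N)) = (k * N + r) / N := by
    field_simp
    linear_combination (-(r : ℂ)) * I_sq
  rw [h2]
  field_simp

theorem tendsto_tsum_exp_neg_quadratic {α : Type*} {l : Filter α} {w : α → ℂ}
    (hw : Tendsto (fun t ↦ (w t).re) l atTop) (x : ℝ) :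
    Tendsto (fun t ↦ ∑' k : ℤ, cexp (-Real.pi * w t * k ^ 2 + 2 * Real.pi * (-(I * x)) * k)) l
      (𝓝 1) := by
  have key : ∀ t (k : ℤ), ‖cexp (-Real.pi * w t * k ^ 2 + 2 * Real.pi * (-(I * x)) * k)‖ =
      Real.exp (-Real.pi * (w t).re * k ^ 2) := by
    intro t k
    rw [Complex.norm_exp]
    congr 1
    have : (-Real.pi * w t * k ^ 2 + 2 * Real.pi * (-(I * x)) * k : ℂ) =
      ((-Real.pi * k ^ 2 : ℝ) : ℂ) * w t + ((-2 * Real.pi * x * k : ℝ) : ℂ) * I := by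
        push_cast; ring
    rw [this, Complex.add_re, Complex.re_ofReal_mul, Complex.re_ofReal_mul]
    simp
    ring
  have h : (1 : ℂ) = ∑' k : ℤ, if k = 0 then 1 else 0 := by simp
  rw [h]
  refine tendsto_tsum_of_dominated_convergence
    (summable_exp_neg_pi_mul_int_sq one_pos) (fun k ↦ ?_) ?_
  · split_ifs with hk
    · simpa [hk] using tendsto_const_nhds
    · rw [tendsto_zero_iff_norm_tendsto_zero]
      simp_rw [key]
      refine Real.tendsto_exp_atBot.comp ?_
      have hk' : 0 < Real.pi * (k : ℝ) ^ 2 := by positivity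
      refine (tendsto_neg_atTop_atBot.comp (hw.const_mul_atTop hk')).congr fun t ↦ ?_
      simp only [Function.comp]
      ring
  · filter_upwards [hw.eventually_ge_atTop 1] with t ht k
    rw [key, Real.exp_le_exp, neg_mul, neg_mul, neg_mul, neg_mul, neg_le_neg_iff]
    gcongr

theorem tendsto_tsum_periodic_mul_exp {α : Type*} {l : Filter α} {N : ℕ} [NeZero N] {f : ℤ → ℂ}
    (hf : Function.Periodic f N) {w : α → ℂ} (hw : Tendsto (fun t ↦ (w t).re) l atTop) :
    Tendsto (fun t ↦ (∑' n : ℤ, f n * cexp (-Real.pi * (n ^ 2 / (N ^ 2 * w t)))) /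
      w t ^ (1 / 2 : ℂ)) l (𝓝 (∑ r : Fin N, f r)) := by
  have h : Tendsto (fun t ↦ ∑ r : Fin N, f r *
        ∑' k : ℤ, cexp (-Real.pi * w t * k ^ 2 + 2 * Real.pi * (-(I * (r / N))) * k)) l
        (𝓝 (∑ r : Fin N, f r * 1)) := by
    refine tendsto_finsetSum _ fun r _ ↦ Tendsto.const_mul _ ?_
    simpa using tendsto_tsum_exp_neg_quadratic hw ((r : ℝ) / N)
  simp only [mul_one] at h
  refine h.congr' ?_
  filter_upwards [hw.eventually_gt_atTop 0] with t ht
  have hw0 : w t ≠ 0 := by intro h; simp [h] at ht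
  rw [tsum_periodic_mul_exp_eq hf ht, mul_div_cancel_left₀]
  simp [cpow_eq_zero_iff, hw0]

theorem sum_exp_two_pi_mul_sq_div (q : ℕ) [NeZero q] :
    ∑ r : Fin q, cexp (2 * Real.pi * I * (r ^ 2 / q)) =
      √q * ((1 + I) / 2) * (1 + cexp (-Real.pi * I * q / 2)) := by
  have hq : (0 : ℝ) < q := by exact_mod_cast Nat.pos_of_ne_zero (NeZero.ne q)
  have hq0 : (q : ℂ) ≠ 0 := NeZero.ne _
  set f : ℤ → ℂ := fun n ↦ cexp (2 * Real.pi * I * (n ^ 2 / q)) with hf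
  set g : ℤ → ℂ := fun n ↦ cexp (-Real.pi * I * q * n ^ 2 / 2) with hg
  have hfper : Function.Periodic f q := by
    intro n
    simp only [hf]
    rw [Complex.exp_eq_exp_iff_exists_int]
    refine ⟨2 * n + q, ?_⟩
    push_cast
    field_simp
    ring
  have hgper : Function.Periodic g (2 : ℕ) := by
    intro n
    simp only [hg]
    rw [Complex.exp_eq_exp_iff_exists_int]
    refine ⟨-(q * (n + 1)), ?_⟩
    push_cast
    ring
  set w₁ : ℝ → ℂ := fun t ↦ ((t / q ^ 2 : ℝ) : ℂ) with hw₁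
  set w₂ : ℝ → ℂ := fun t ↦ ((t / q ^ 2 : ℝ) : ℂ) * (1 + I * q / 2 * ((t⁻¹ : ℝ) : ℂ)) with hw₂
  set a : ℝ → ℂ := fun t ↦ ((t⁻¹ : ℝ) : ℂ) - 2 * I / q with ha
  have hw₁t : Tendsto (fun t ↦ (w₁ t).re) atTop atTop := by
    simp only [hw₁, Complex.ofReal_re]
    exact tendsto_id.atTop_div_const (by positivity)
  have hw₂t : Tendsto (fun t ↦ (w₂ t).re) atTop atTop := by
    refine hw₁t.congr fun t ↦ ?_
    simp only [hw₂, hw₁, Complex.re_ofReal_mul, Complex.ofReal_re]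
    simp
  have h₁ := tendsto_tsum_periodic_mul_exp hfper hw₁t
  have h₂ := tendsto_tsum_periodic_mul_exp hgper hw₂t
  have hinv : Tendsto (fun t : ℝ ↦ ((t⁻¹ : ℝ) : ℂ)) atTop (𝓝 0) := by
    exact_mod_cast (Complex.continuous_ofReal.tendsto 0).comp tendsto_inv_atTop_zero
  have h₃ : Tendsto (fun t ↦ (1 + I * q / 2 * ((t⁻¹ : ℝ) : ℂ)) ^ (1 / 2 : ℂ)) atTop (𝓝 1) := by
    have h : Tendsto (fun t : ℝ ↦ 1 + I * q / 2 * ((t⁻¹ : ℝ) : ℂ)) atTop (𝓝 1) := by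
      simpa using (hinv.const_mul (I * q / 2)).const_add 1
    simpa using h.cpow (tendsto_const_nhds (x := (1 / 2 : ℂ))) (by simp)
  have h₄ : Tendsto (fun t ↦ a t ^ (1 / 2 : ℂ)) atTop (𝓝 ((1 - I) / √q)) := by
    have h : Tendsto a atTop (𝓝 (-(2 * I / q))) := by
      simpa [ha] using hinv.sub_const (2 * I / q)
    have h5 : (-(2 * I / q) : ℂ) ^ (1 / 2 : ℂ) = (1 - I) / √q := by
      have h6 : (-(2 * I / q) : ℂ) = ((1 - I) / √q) ^ 2 := by
        have : ((√q : ℝ) : ℂ) ^ 2 = q := by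
          rw [← Complex.ofReal_pow, Real.sq_sqrt hq.le]; simp
        rw [div_pow, this, sub_sq, I_sq]
        ring
      rw [h6, one_div, Complex.sq_cpow_two_inv]
      rw [Complex.div_ofReal_re]
      have : 0 < √(q : ℝ) := Real.sqrt_pos.2 hq
      simpa using this
    rw [← h5]
    refine h.cpow tendsto_const_nhds ?_
    refine Or.inr ?_
    have : (-(2 * I / q) : ℂ) = ((-(2 / q) : ℝ) : ℂ) * I := by push_cast; ring
    rw [this, Complex.im_ofReal_mul]
    simp [NeZero.ne q]
  have h₅ := (h₂.mul h₃).div h₄ (by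
    simp only [ne_eq, div_eq_zero_iff, not_or]
    refine ⟨fun h ↦ ?_, by simpa using hq.ne'⟩
    simpa using congrArg Complex.re h)
  have h₆ := tendsto_nhds_unique (h₁.congr' (f₂ := _) ?_) h₅
  · simp only [hf, hg, Fin.sum_univ_two] at h₆
    push_cast at h₆
    rw [h₆]
    have hI : (1 - I : ℂ) ≠ 0 := fun h ↦ by simpa using congrArg Complex.re h
    have hs : ((√q : ℝ) : ℂ) ≠ 0 := by simpa using hq.ne'
    simp
    field_simp
    linear_combination (1 + cexp (-(Real.pi * I * q / 2))) * I_sq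
  · filter_upwards [eventually_gt_atTop 0] with t ht
    have ht0 : (t : ℂ) ≠ 0 := by exact_mod_cast ht.ne'
    have hare : 0 < (a t).re := by
      have : (2 * I / q : ℂ) = ((2 / q : ℝ) : ℂ) * I := by push_cast; ring
      simp only [ha, this, Complex.sub_re, Complex.re_ofReal_mul]
      simpa using ht
    have hpos : 0 < t / (q : ℝ) ^ 2 := by positivity
    have hX : (1 + I * q / 2 * ((t⁻¹ : ℝ) : ℂ)) ≠ 0 := by
      intro h
      have := congrArg Complex.re h
      simp at this
    have hw : w₂ t ^ (1 / 2 : ℂ) =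
        w₁ t ^ (1 / 2 : ℂ) * (1 + I * q / 2 * ((t⁻¹ : ℝ) : ℂ)) ^ (1 / 2 : ℂ) := by
      have hne : ((t / q ^ 2 : ℝ) : ℂ) ≠ 0 := by exact_mod_cast hpos.ne'
      simp only [hw₁, hw₂]
      rw [cpow_def_of_ne_zero (mul_ne_zero hne hX), cpow_def_of_ne_zero hne,
        cpow_def_of_ne_zero hX, Complex.log_ofReal_mul hpos hX, ← Complex.ofReal_log hpos.le,
        ← Complex.exp_add, add_mul]
    have hS : ∑' n : ℤ, f n * cexp (-Real.pi * (n ^ 2 / (q ^ 2 * w₁ t))) =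
        1 / a t ^ (1 / 2 : ℂ) *
          ∑' n : ℤ, g n * cexp (-Real.pi * (n ^ 2 / ((2 : ℕ) ^ 2 * w₂ t))) := by
      have hL : ∀ n : ℤ, f n * cexp (-Real.pi * (n ^ 2 / (q ^ 2 * w₁ t))) =
          cexp (-Real.pi * a t * n ^ 2) := by
        intro n
        simp only [hf, hw₁, ha]
        rw [← Complex.exp_add]
        congr 1
        push_cast
        field_simp
        ring
      have hR : ∀ n : ℤ, g n * cexp (-Real.pi * (n ^ 2 / ((2 : ℕ) ^ 2 * w₂ t))) =
          cexp (-Real.pi / a t * n ^ 2) := by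
        intro n
        have ha0 : a t ≠ 0 := by intro h; simp [h] at hare
        have hX' : (2 * t + I * q : ℂ) ≠ 0 := by
          intro h
          have := congrArg Complex.re h
          simp at this
          exact ht.ne' this
        have hwinv : 1 / ((2 : ℕ) ^ 2 * w₂ t) = q ^ 2 / (2 * (2 * t + I * q)) := by
          simp only [hw₂]
          push_cast
          have : (1 + I * q / 2 * (t : ℂ)⁻¹) = (2 * t + I * q) / (2 * t) := by field_simp
          rw [this]
          field_simp
        have hainv : 1 / a t = I * q * t / (2 * t + I * q) := by
          rw [div_eq_div_iff ha0 hX']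
          simp only [ha]
          push_cast
          field_simp
          linear_combination (2 * t : ℂ) * I_sq
        simp only [hg]
        rw [← Complex.exp_add]
        congr 1
        rw [div_eq_mul_one_div ((n : ℂ) ^ 2), hwinv, div_eq_mul_one_div _ (a t), hainv]
        field_simp
        linear_combination (-q * n ^ 2 : ℂ) * I_sq
      simp_rw [hL, hR]
      exact Complex.tsum_exp_neg_mul_int_sq hare
    have hw₁0 : w₁ t ^ (1 / 2 : ℂ) ≠ 0 := by
      have hne : ((t / q ^ 2 : ℝ) : ℂ) ≠ 0 := by exact_mod_cast hpos.ne'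
      simp only [hw₁, ne_eq, cpow_eq_zero_iff, hne, false_and, not_false_eq_true]
    have hX2 : (1 + I * q / 2 * ((t⁻¹ : ℝ) : ℂ)) ^ (1 / 2 : ℂ) ≠ 0 := by
      simp only [ne_eq, cpow_eq_zero_iff, hX, false_and, not_false_eq_true]
    simp only [Pi.div_apply]
    rw [hS, hw]
    generalize (1 + I * q / 2 * ((t⁻¹ : ℝ) : ℂ)) ^ (1 / 2 : ℂ) = u at hX2 ⊢
    field_simp

theorem eN_add (q : ℕ) (x y : ℤ) : eN q (x + y) = eN q x * eN q y := by
  simp only [eN]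
  rw [← Complex.exp_add]
  congr 1
  push_cast
  ring

theorem eN_mul_self (q : ℕ) (x : ℤ) : eN q (q * x) = 1 := by
  rcases eq_or_ne q 0 with rfl | hq
  · simp [eN]
  · have hq' : (q : ℂ) ≠ 0 := by exact_mod_cast hq
    rw [eN, Complex.exp_eq_one_iff]
    refine ⟨x, ?_⟩
    push_cast
    field_simp

theorem eN_mul_mul {d : ℕ} (hd : d ≠ 0) (q : ℕ) (x : ℤ) : eN (d * q) (d * x) = eN q x := by
  have hd' : (d : ℂ) ≠ 0 := by exact_mod_cast hd
  simp only [eN]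
  congr 1
  push_cast
  rw [mul_left_comm, mul_div_mul_left _ _ hd']

theorem stdAddChar_intCast_eq_eN (q : ℕ) [NeZero q] (x : ℤ) :
    ZMod.stdAddChar (x : ZMod q) = eN q x :=
  ZMod.stdAddChar_coe x

theorem sum_zmod_val {M : Type*} [AddCommMonoid M] (q : ℕ) [NeZero q] (G : ℕ → M) :
    ∑ x : ZMod q, G x.val = ∑ x ∈ Finset.range q, G x := by
  refine Finset.sum_nbij' (fun x ↦ x.val) (fun x ↦ (x : ZMod q)) ?_ ?_ ?_ ?_ ?_
  · intro x _
    exact Finset.mem_range.2 (ZMod.val_lt x)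
  · simp
  · simp
  · intro x hx
    exact ZMod.val_cast_of_lt (Finset.mem_range.1 hx)
  · simp

theorem sum_range_mul_eq {M : Type*} [AddCommMonoid M] (m n : ℕ) (G : ℕ → M) :
    ∑ x ∈ Finset.range (m * n), G x =
      ∑ y ∈ Finset.range m, ∑ z ∈ Finset.range n, G (y + m * z) := by
  rw [Finset.sum_comm]
  induction n with
  | zero => simp
  | succ n ih =>
    rw [mul_add_one, Finset.sum_range_add, ih, Finset.sum_range_succ]
    simp only [add_comm]

/-- The quadratic Gauss sum `∑ e_q(a x²)` over `x` modulo `q`. -/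
noncomputable def quadGaussSum (q : ℕ) (a : ℤ) : ℂ :=
  ∑ x ∈ Finset.range q, eN q (a * (x : ℤ) ^ 2)

theorem quadGaussSum_eq_sum_zmod (q : ℕ) [NeZero q] (a : ℤ) :
    quadGaussSum q a = ∑ x : ZMod q, ZMod.stdAddChar ((a : ZMod q) * x ^ 2) := by
  rw [quadGaussSum, ← sum_zmod_val q fun x ↦ eN q (a * (x : ℤ) ^ 2)]
  refine Finset.sum_congr rfl fun x _ ↦ ?_
  rw [← stdAddChar_intCast_eq_eN]
  simp

theorem quadGaussSum_mul_of_coprime {m n : ℕ} (hm : m ≠ 0) (hn : n ≠ 0) (hmn : m.Coprime n)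
    (a : ℤ) : quadGaussSum (m * n) a = quadGaussSum m (a * n) * quadGaussSum n (a * m) := by
  have : NeZero m := ⟨hm⟩
  have : NeZero n := ⟨hn⟩
  let φ : ZMod m × ZMod n → ZMod (m * n) := fun p ↦ ((n * p.1.val + m * p.2.val : ℕ) : ZMod (m * n))
  have hφ : Function.Bijective φ := by
    rw [Fintype.bijective_iff_injective_and_card]
    refine ⟨fun p p' h ↦ ?_, by simp [ZMod.card]⟩
    simp only [φ] at h
    rw [ZMod.natCast_eq_natCast_iff] at h
    have h1 := h.of_mul_right n
    have h2 := h.of_mul_left m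
    rw [← ZMod.natCast_eq_natCast_iff] at h1 h2
    have hu1 : IsUnit (n : ZMod m) := (ZMod.isUnit_iff_coprime _ _).2 hmn.symm
    have hu2 : IsUnit (m : ZMod n) := (ZMod.isUnit_iff_coprime _ _).2 hmn
    simp only [Nat.cast_add, Nat.cast_mul, CharP.cast_eq_zero, zero_mul, add_zero, zero_add,
      ZMod.natCast_zmod_val] at h1 h2
    exact Prod.ext (hu1.mul_left_cancel h1) (hu2.mul_left_cancel h2)
  rw [quadGaussSum_eq_sum_zmod (m * n), ← hφ.sum_comp, Fintype.sum_prod_type]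
  simp only [quadGaussSum]
  rw [← sum_zmod_val m fun x ↦ eN m (a * n * (x : ℤ) ^ 2),
    ← sum_zmod_val n fun x ↦ eN n (a * m * (x : ℤ) ^ 2), Finset.sum_mul_sum]
  refine Finset.sum_congr rfl fun x _ ↦ Finset.sum_congr rfl fun y _ ↦ ?_
  have h1 : (a : ZMod (m * n)) * φ (x, y) ^ 2 =
      ((n * (a * n * x.val ^ 2) + m * (a * m * y.val ^ 2) +
        (m * n : ℕ) * (2 * a * x.val * y.val) : ℤ) : ZMod (m * n)) := by
    simp only [φ]
    push_cast
    ring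
  rw [h1, stdAddChar_intCast_eq_eN, eN_add, eN_add, eN_mul_self, mul_one, eN_mul_mul hm]
  rw [mul_comm m n, eN_mul_mul hn]

theorem quadGaussSum_prime_sq_mul {p : ℕ} (hp : p.Prime) (hp2 : p ≠ 2) {m : ℕ} (hm : m ≠ 0)
    {a : ℤ} (ha : IsCoprime a p) : quadGaussSum (p * m * p) a = p * quadGaussSum m a := by
  have : Fact p.Prime := ⟨hp⟩
  have hpz : Prime (p : ℤ) := Nat.prime_iff_prime_int.1 hp
  have hinner : ∀ y : ℕ, ∑ z ∈ Finset.range p, eN p (z * (2 * a * y)) =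
      if (y : ZMod p) = 0 then (p : ℂ) else 0 := by
    intro y
    have h2a : ((2 * a : ℤ) : ZMod p) ≠ 0 := by
      rw [Ne, ZMod.intCast_zmod_eq_zero_iff_dvd]
      intro h
      rcases hpz.dvd_or_dvd h with h | h
      · exact hp2 ((Nat.prime_dvd_prime_iff_eq hp Nat.prime_two).1 (by exact_mod_cast h))
      · exact hpz.not_isUnit (ha.isUnit_of_dvd' h dvd_rfl)
    have h := AddChar.sum_mulShift ((2 * a * y : ℤ) : ZMod p) (ZMod.isPrimitive_stdAddChar p)
    rw [← sum_zmod_val p fun z ↦ eN p (z * (2 * a * y))]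
    simp_rw [← stdAddChar_intCast_eq_eN]
    have h3 : ((2 * a * y : ℤ) : ZMod p) = 0 ↔ (y : ZMod p) = 0 := by
      rw [Int.cast_mul, mul_eq_zero, or_iff_right h2a, Int.cast_natCast]
    simp only [h3, ZMod.card] at h
    have h5 : (if (y : ZMod p) = 0 then (p : ℂ) else 0) =
        ((if (y : ZMod p) = 0 then p else 0 : ℕ) : ℂ) := by simp
    rw [h5, ← h]
    refine Finset.sum_congr rfl fun z _ ↦ ?_
    simp
  rw [quadGaussSum, sum_range_mul_eq]
  have hsplit : ∀ y z : ℕ, eN (p * m * p) (a * ((y + p * m * z : ℕ) : ℤ) ^ 2) =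
      eN (p * m * p) (a * (y : ℤ) ^ 2) * eN p (z * (2 * a * y)) := by
    intro y z
    have h1 : a * ((y + p * m * z : ℕ) : ℤ) ^ 2 = a * (y : ℤ) ^ 2 +
        (p * m : ℕ) * (z * (2 * a * y)) + (p * m * p : ℕ) * (a * m * z ^ 2) := by
      push_cast
      ring
    rw [h1, eN_add, eN_add, eN_mul_self, mul_one, eN_mul_mul (mul_ne_zero hp.ne_zero hm)]
  simp_rw [hsplit, ← Finset.mul_sum, hinner]
  rw [sum_range_mul_eq, Finset.sum_comm, quadGaussSum, Finset.mul_sum]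
  refine Finset.sum_congr rfl fun w _ ↦ ?_
  rw [Finset.sum_eq_single 0]
  · have h2 : a * ((0 + p * w : ℕ) : ℤ) ^ 2 = (p * p : ℕ) * (a * w ^ 2) := by
      push_cast
      ring
    have h3 : p * m * p = p * p * m := by ring
    rw [h2, h3, eN_mul_mul (mul_ne_zero hp.ne_zero hp.ne_zero), if_pos (by simp), mul_comm]
  · intro r hr hr0
    rw [if_neg, mul_zero]
    simp only [Nat.cast_add, Nat.cast_mul, CharP.cast_eq_zero, zero_mul, add_zero]
    rw [ZMod.natCast_eq_zero_iff]
    exact Nat.not_dvd_of_pos_of_lt (Nat.pos_of_ne_zero hr0) (Finset.mem_range.1 hr)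
  · intro h
    exact absurd (Finset.mem_range.2 hp.pos) h

theorem quadGaussSum_prime {p : ℕ} (hp : p.Prime) (hp2 : p ≠ 2) {a : ℤ} (ha : IsCoprime a p) :
    quadGaussSum p a = jacobiSym a p * quadGaussSum p 1 := by
  have : Fact p.Prime := ⟨hp⟩
  have ha0 : (a : ZMod p) ≠ 0 := by
    rw [Ne, ZMod.intCast_zmod_eq_zero_iff_dvd]
    intro h
    exact (Nat.prime_iff_prime_int.1 hp).not_isUnit (ha.isUnit_of_dvd' h dvd_rfl)
  have hchar : ringChar (ZMod p) ≠ 2 := by rwa [ZMod.ringChar_zmod_n]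
  have key : ∀ b : ZMod p, b ≠ 0 → ∑ x : ZMod p, ZMod.stdAddChar (b * x ^ 2) =
      ∑ t : ZMod p, (quadraticChar (ZMod p) t : ℂ) * ZMod.stdAddChar (b * t) := by
    intro b hb
    have h0 := AddChar.sum_mulShift b (ZMod.isPrimitive_stdAddChar p)
    rw [if_neg hb, Nat.cast_zero] at h0
    rw [← Finset.sum_fiberwise' Finset.univ (fun x : ZMod p ↦ x ^ 2)
      (fun t ↦ ZMod.stdAddChar (b * t))]
    have h1 : ∀ t : ZMod p, ∑ x : ZMod p with x ^ 2 = t, ZMod.stdAddChar (b * t) =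
        (quadraticChar (ZMod p) t : ℂ) * ZMod.stdAddChar (b * t) +
          ZMod.stdAddChar (t * b) := by
      intro t
      have h2 := quadraticChar_card_sqrts hchar t
      have h3 : {x : ZMod p | x ^ 2 = t}.toFinset = Finset.univ.filter fun x ↦ x ^ 2 = t := by
        ext x; simp
      rw [h3] at h2
      have h4 : ((Finset.univ.filter fun x : ZMod p ↦ x ^ 2 = t).card : ℂ) =
        quadraticChar (ZMod p) t + 1 := by exact_mod_cast h2
      rw [Finset.sum_const, nsmul_eq_mul, h4, mul_comm t b]
      ring
    simp_rw [h1]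
    rw [Finset.sum_add_distrib, h0, add_zero]
  have hsq : (quadraticChar (ZMod p) a : ℂ) * quadraticChar (ZMod p) a = 1 := by
    have := quadraticChar_sq_one ha0
    rw [← sq]
    exact_mod_cast this
  rw [quadGaussSum_eq_sum_zmod, quadGaussSum_eq_sum_zmod, key _ ha0, Int.cast_one, key _ one_ne_zero,
    ← jacobiSym.legendreSym.to_jacobiSym, legendreSym]
  rw [← (mulLeft_bijective₀ (a : ZMod p) ha0).sum_comp
    fun t ↦ (quadraticChar (ZMod p) t : ℂ) * ZMod.stdAddChar (1 * t), Finset.mul_sum]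
  refine Finset.sum_congr rfl fun t _ ↦ ?_
  simp only [map_mul, Int.cast_mul, one_mul, ← mul_assoc, hsq]

theorem quadGaussSum_eq_jacobiSym_mul (q : ℕ) (hq : Odd q) (a : ℤ) (ha : IsCoprime a q) :
    quadGaussSum q a = jacobiSym a q * quadGaussSum q 1 := by
  induction q using Nat.strong_induction_on generalizing a with
  | _ q ih =>
    have hq0 : q ≠ 0 := hq.pos.ne'
    rcases eq_or_ne q 1 with rfl | hq1
    · simp [quadGaussSum]
    obtain ⟨p, hp, m, rfl⟩ := Nat.exists_prime_and_dvd hq1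
    rw [Nat.odd_mul] at hq
    have hm0 : m ≠ 0 := right_ne_zero_of_mul hq0
    have : NeZero m := ⟨hm0⟩
    have : NeZero p := ⟨hp.ne_zero⟩
    have hp2 : p ≠ 2 := by rintro rfl; exact absurd hq.1 (by decide)
    rw [Nat.cast_mul, IsCoprime.mul_right_iff] at ha
    have hmlt : m < p * m := lt_mul_of_one_lt_left hq.2.pos hp.one_lt
    by_cases hpm : p ∣ m
    · obtain ⟨k, rfl⟩ := hpm
      have hk := Nat.odd_mul.1 hq.2
      have ha2 := ha.2
      rw [Nat.cast_mul, IsCoprime.mul_right_iff] at ha2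
      have hk0 : k ≠ 0 := hk.2.pos.ne'
      have : NeZero k := ⟨hk0⟩
      have hJ : jacobiSym a (p * (p * k)) = jacobiSym a k := by
        rw [jacobiSym.mul_right, jacobiSym.mul_right, ← mul_assoc, ← sq,
          jacobiSym.sq_one (Int.isCoprime_iff_gcd_eq_one.1 ha.1), one_mul]
      have hklt : k < p * (p * k) :=
        (lt_mul_of_one_lt_left hk.2.pos hp.one_lt).trans hmlt
      rw [hJ, mul_comm p (p * k), quadGaussSum_prime_sq_mul hp hp2 hk0 ha.1,
        quadGaussSum_prime_sq_mul hp hp2 hk0 isCoprime_one_left, ih k hklt hk.2 a ha2.2]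
      ring
    · have hpm' : p.Coprime m := (Nat.Prime.coprime_iff_not_dvd hp).2 hpm
      have hpmz : IsCoprime (p : ℤ) m := Nat.isCoprime_iff_coprime.2 hpm'
      rw [quadGaussSum_mul_of_coprime hp.ne_zero hm0 hpm',
        quadGaussSum_mul_of_coprime hp.ne_zero hm0 hpm',
        quadGaussSum_prime hp hp2 (ha.1.mul_left hpmz.symm),
        quadGaussSum_prime hp hp2 (isCoprime_one_left.mul_left hpmz.symm),
        ih m hmlt hq.2 _ (ha.2.mul_left hpmz), ih m hmlt hq.2 _ (isCoprime_one_left.mul_left hpmz),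
        jacobiSym.mul_right, jacobiSym.mul_left, jacobiSym.mul_left]
      push_cast
      simp only [one_mul]
      ring

theorem quadGaussSum_one (q : ℕ) (hq : Odd q) :
    quadGaussSum q 1 = Real.sqrt q * epsFactor q := by
  have : NeZero q := ⟨hq.pos.ne'⟩
  have h : quadGaussSum q 1 = ∑ r : Fin q, cexp (2 * Real.pi * I * (r ^ 2 / q)) := by
    rw [quadGaussSum, Finset.sum_range]
    refine Finset.sum_congr rfl fun r _ ↦ ?_
    simp [eN, mul_div_assoc]
  have hpow : cexp (-Real.pi * I * q / 2) = (-I) ^ q := by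
    rw [← Complex.exp_neg_pi_div_two_mul_I, ← Complex.exp_nat_mul]
    congr 1
    ring
  rw [h, sum_exp_two_pi_mul_sq_div, hpow, mul_assoc]
  congr 1
  have h4 : (-I) ^ 4 = 1 := by rw [neg_pow, I_pow_four]; norm_num
  rw [← Nat.div_add_mod q 4, pow_add, pow_mul, h4, one_pow, one_mul, Nat.div_add_mod, epsFactor]
  rcases Nat.odd_mod_four_iff.1 (Nat.odd_iff.1 hq) with h | h
  · rw [h, if_pos rfl]
    linear_combination (-1 / 2 : ℂ) * I_sq
  · rw [h, if_neg (by norm_num)]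
    linear_combination (-(I ^ 2 + I) / 2 + 1 / 2 : ℂ) * I_sq

/-- Evaluation of the complete quadratic exponential sum modulo an odd number. -/
theorem quadratic_gauss_sum_eval (q : ℕ) (hq : Odd q) (hqpos : 0 < q) (a b c : ℤ)
    (ha : Int.gcd a q = 1) (hc : 4 * a * c ≡ 1 [ZMOD (q : ℕ)]) :
    haveI : NeZero q := ⟨hqpos.ne'⟩
    ∑ x : ZMod q, eN q (a * (x.val : ℤ) ^ 2 + b * (x.val : ℤ)) =
      Real.sqrt q * epsFactor q * jacobiSym a q * eN q (-(c * b ^ 2)) := by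
  have : NeZero q := ⟨hqpos.ne'⟩
  have hc' : (4 * a * c : ZMod q) = 1 := by
    have := (ZMod.intCast_eq_intCast_iff _ _ _).2 hc
    exact_mod_cast this
  have hsquare : ∀ x : ZMod q, eN q (a * (x.val : ℤ) ^ 2 + b * (x.val : ℤ)) =
      ZMod.stdAddChar ((a : ZMod q) * (x + (2 * c * b : ZMod q)) ^ 2) * eN q (-(c * b ^ 2)) := by
    intro x
    rw [← stdAddChar_intCast_eq_eN, ← stdAddChar_intCast_eq_eN, ← AddChar.map_add_eq_mul]
    congr 1
    push_cast
    rw [ZMod.natCast_zmod_val]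
    linear_combination (-(b * x) - c * b ^ 2 : ZMod q) * hc'
  have hshift := Equiv.sum_comp (Equiv.addRight (2 * c * b : ZMod q))
    fun x ↦ ZMod.stdAddChar ((a : ZMod q) * x ^ 2)
  simp only [Equiv.coe_addRight] at hshift
  simp_rw [hsquare]
  rw [← Finset.sum_mul, hshift, ← quadGaussSum_eq_sum_zmod,
    quadGaussSum_eq_jacobiSym_mul q hq a (Int.isCoprime_iff_gcd_eq_one.2 ha), quadGaussSum_one q hq]
  ring
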